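/- arXiv:2312.00724 — 2 statements merged into one kernel-verified Lean document; each statement's English description precedes it below -/
import Mathlib

section
/- Let V be a real normed vector space, S ⊆ V a subset, and n ≥ 1, p ≥ 1 natural numbers. Then the polynomial Kolmogorov (n,p)-width of S is sandwiched between two classical Kolmogorov widths: d_{s(n,p)}(S;V) ≤ d^poly_{n,p}(S;V) ≤ d_n(S;V), where s(n,p) = Σ_{k=0}^p C(n+k−1, k). -/
open scoped ENNReal NNReal

noncomputable section

variable {V : Type*} [NormedAddCommGroup V] [NormedSpace ℝ V]

/-- Worst best-approximation error of `S` in `T`, valued in `[0,∞]`: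
`dist(S,T) = sup_{s ∈ S} inf_{t ∈ T} ‖s - t‖`. -/
def distSet (S T : Set V) : ℝ≥0∞ :=
  ⨆ s ∈ S, ⨅ t ∈ T, (‖s - t‖₊ : ℝ≥0∞)

/-- Kolmogorov `n`-width: infimum of `dist(S,U)` over linear subspaces `U` of dimension
at most `n`. -/
def kolWidth (n : ℕ) (S : Set V) : ℝ≥0∞ :=
  ⨅ (U : Submodule ℝ V) (_ : Module.rank ℝ U ≤ n), distSet S (U : Set V)

/-- Multi-indices on `Fin l` of total degree at most `p`. -/
def multiIndices (l p : ℕ) : Finset (Fin l → ℕ) :=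
  (Fintype.piFinset fun _ => Finset.range (p + 1)).filter fun α => ∑ i, α i ≤ p

/-- `D : ℝ^l → V` is a polynomial mapping of degree `p`:
`D x = Σ_{|α| ≤ p} x^α • v_α` for some coefficient vectors `v_α ∈ V`. -/
def IsPolyMap {l : ℕ} (p : ℕ) (D : (Fin l → ℝ) → V) : Prop :=
  ∃ v : (Fin l → ℕ) → V, ∀ x, D x = ∑ α ∈ multiIndices l p, (∏ i, x i ^ α i) • v α

/-- `s(n,p) = Σ_{k=0}^p C(n+k-1, k)`, the number of multi-indices of degree at most `p`. -/
def sTot (n p : ℕ) : ℕ := ∑ k ∈ Finset.range (p + 1), Nat.choose (n + k - 1) k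

/-- Polynomial Kolmogorov `(n,p)`-width: infimum of `dist(S, image D)` over `l ≤ n` and
polynomial mappings `D` of degree `p` on `ℝ^l`. -/
def polyKolWidth (n p : ℕ) (S : Set V) : ℝ≥0∞ :=
  ⨅ (l : ℕ) (_ : l ≤ n) (D : (Fin l → ℝ) → V) (_ : IsPolyMap p D),
    distSet S (Set.range D)

/-- Polynomial manifold `(n,p)`-width: infimum over `l ≤ n`, polynomial mappings `D` of
degree `p` on `ℝ^l` and continuous encoders `e : V → ℝ^l` of `sup_{s ∈ S} ‖s - D (e s)‖`. -/
def polyManiWidth (n p : ℕ) (S : Set V) : ℝ≥0∞ :=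
  ⨅ (l : ℕ) (_ : l ≤ n) (D : (Fin l → ℝ) → V) (_ : IsPolyMap p D)
    (e : V → (Fin l → ℝ)) (_ : Continuous e),
    ⨆ s ∈ S, (‖s - D (e s)‖₊ : ℝ≥0∞)

theorem distSet_anti {S T T' : Set V} (h : T ⊆ T') : distSet S T' ≤ distSet S T := by
  unfold distSet
  exact iSup₂_mono fun s _ => biInf_mono h

theorem card_multi {l n : ℕ} (p : ℕ) (h : l ≤ n) : (multiIndices l p).card ≤ sTot n p := by
  have hsub : multiIndices l p ⊆ (Finset.range (p + 1)).biUnion fun k =>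
      (Finset.finsuppAntidiag (Finset.univ : Finset (Fin l)) k).image (fun f : Fin l →₀ ℕ => (f : Fin l → ℕ)) := by
    intro α hα
    simp only [multiIndices, Finset.mem_filter] at hα
    simp only [Finset.mem_biUnion, Finset.mem_image, Finset.mem_range]
    refine ⟨∑ i, α i, by omega, Finsupp.equivFunOnFinite.symm α, ?_, by simp⟩
    simp [Finset.mem_finsuppAntidiag]
  refine (Finset.card_le_card hsub).trans (Finset.card_biUnion_le.trans ?_)
  refine Finset.sum_le_sum fun k _ => Finset.card_image_le.trans ?_
  rw [Finset.card_finsuppAntidiag_nat_eq_choose]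
  apply Nat.choose_le_choose
  simp only [Finset.card_univ, Fintype.card_fin]
  omega

theorem isPolyMap_linear {l p : ℕ} (hp : 1 ≤ p) (b : Fin l → V) :
    IsPolyMap p (fun x : Fin l → ℝ => ∑ i, x i • b i) := by
  classical
  refine ⟨fun α => ∑ i, if α = Pi.single i 1 then b i else 0, fun x => ?_⟩
  simp only [Finset.smul_sum]
  rw [Finset.sum_comm]
  refine Finset.sum_congr rfl fun j _ => ?_
  have hm : (Pi.single j 1 : Fin l → ℕ) ∈ multiIndices l p := by
    simp only [multiIndices, Finset.mem_filter, Fintype.mem_piFinset, Finset.mem_range]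
    refine ⟨fun a => ?_, by simpa using hp⟩
    by_cases h : a = j
    · subst h; simp; omega
    · simp [h]
  rw [Finset.sum_eq_single_of_mem _ hm]
  · rw [if_pos rfl, Finset.prod_eq_single j]
    · simp
    · intro i _ hi; simp [hi]
    · simp
  · intro α _ hα; simp [hα]

/-- the polynomial Kolmogorov `(n,p)`-width is sandwiched between the
classical Kolmogorov `s(n,p)`-width and `n`-width. -/
theorem stmt1 (V : Type*) [NormedAddCommGroup V] [NormedSpace ℝ V]
    (S : Set V) (n p : ℕ) (hn : 1 ≤ n) (hp : 1 ≤ p) :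
    kolWidth (sTot n p) S ≤ polyKolWidth n p S ∧ polyKolWidth n p S ≤ kolWidth n S := by
  constructor
  · unfold polyKolWidth
    refine le_iInf fun l => le_iInf fun hl => le_iInf fun D => le_iInf fun hD => ?_
    obtain ⟨v, hv⟩ := hD
    classical
    have hr : Module.rank ℝ (Submodule.span ℝ (((multiIndices l p).image v : Finset V) : Set V))
        ≤ (sTot n p : ℕ) := by
      refine (rank_span_finset_le _).trans ?_
      exact_mod_cast Finset.card_image_le.trans (card_multi p hl)
    refine (iInf₂_le (f := fun (U : Submodule ℝ V) (_ : Module.rank ℝ U ≤ (sTot n p : ℕ)) =>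
      distSet S (U : Set V)) _ hr).trans (distSet_anti ?_)
    rintro _ ⟨x, rfl⟩
    rw [hv]
    refine Submodule.sum_mem _ fun α hα => Submodule.smul_mem _ _ (Submodule.subset_span ?_)
    exact Finset.mem_coe.2 (Finset.mem_image_of_mem v hα)
  · unfold kolWidth
    refine le_iInf fun U => le_iInf fun hU => ?_
    have hfin : Module.Finite ℝ U :=
      Module.rank_lt_aleph0_iff.1 (hU.trans_lt (Cardinal.natCast_lt_aleph0))
    have hl : Module.finrank ℝ U ≤ n := by
      rw [← Module.finrank_eq_rank] at hU
      exact_mod_cast hU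
    let b := Module.finBasis ℝ U
    unfold polyKolWidth
    refine (iInf_le _ (Module.finrank ℝ U)).trans ((iInf_le _ hl).trans ?_)
    refine ((iInf_le _ _).trans ((iInf_le _ (isPolyMap_linear hp fun i => (b i : V))).trans
      (distSet_anti ?_)))
    intro u hu
    refine ⟨b.repr ⟨u, hu⟩, ?_⟩
    have := congrArg (Subtype.val) (b.sum_repr ⟨u, hu⟩)
    simpa only [Submodule.coe_sum, Submodule.coe_smul] using this

end
end

section
/- Let V be a real normed vector space and S ⊆ V a subset whose Kolmogorov n-widths decay at most algebraically, i.e., there exist M > 0 and α > 0 with d_m(S;V) ≥ M · m^(−α) for all m ≥ 1. Then for every p ≥ 2 and every n ≥ 4, the polynomial Kolmogorov (n,p)-width satisfies d^poly_{n,p}(S;V) ≥ M · n^(−αp). -/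
open scoped ENNReal NNReal

noncomputable section

variable {V : Type*} [NormedAddCommGroup V] [NormedSpace ℝ V]

theorem card_multiIndices_le (l p : ℕ) : (multiIndices l p).card ≤ (l + p).choose p := by
  have hc : Fintype.card (Sym (Fin (l + 1)) p) = (l + p).choose p := by
    rw [Sym.card_sym_eq_choose, Fintype.card_fin]
    congr 1
    omega
  rw [← hc, ← Fintype.card_coe]
  have hs : ∀ a : multiIndices l p, ∑ i, a.1 i ≤ p := fun a =>
    (Finset.mem_filter.1 a.2).2
  refine Fintype.card_le_of_injective (fun a : multiIndices l p =>
    (Sym.equivNatSumOfFintype (Fin (l + 1)) p).symm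
      ⟨Fin.cons (p - ∑ i, a.1 i) a.1, by
        have := hs a
        rw [Fin.sum_univ_succ]
        simp only [Fin.cons_zero, Fin.cons_succ]
        omega⟩) ?_
  intro a b hab
  have h1 := congrArg Subtype.val ((Equiv.injective _) hab)
  refine Subtype.ext (funext fun i => ?_)
  have h2 := congrFun h1 i.succ
  simpa only [Fin.cons_succ] using h2

theorem choose_le_pow_aux (n p : ℕ) (hn : 4 ≤ n) (hp : 2 ≤ p) : (n + p).choose p ≤ n ^ p := by
  induction p, hp using Nat.le_induction with
  | base =>
    have h1 := Nat.add_one_mul_choose_eq (n + 1) 1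
    rw [Nat.choose_one_right] at h1
    have h2 : (n + 1 + 1).choose (1 + 1) = (n + 2).choose 2 := rfl
    rw [h2] at h1
    nlinarith
  | succ p hp ih =>
    have h1 := Nat.add_one_mul_choose_eq (n + p) p
    have h2 : (n + p + 1) * (n + p).choose p ≤ (n * (p + 1)) * n ^ p :=
      Nat.mul_le_mul (by nlinarith) ih
    rw [h1] at h2
    refine Nat.le_of_mul_le_mul_right (c := p + 1) ?_ (by omega)
    calc (n + (p + 1)).choose (p + 1) * (p + 1) ≤ (n * (p + 1)) * n ^ p := h2
      _ = n ^ (p + 1) * (p + 1) := by ring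

/-- if the Kolmogorov widths of `S` decay at most algebraically, i.e.
`d_m(S;V) ≥ M m^{-α}` for all `m ≥ 1`, then for `p ≥ 2` and `n ≥ 4` the polynomial
Kolmogorov `(n,p)`-width satisfies `d^poly_{n,p}(S;V) ≥ M n^{-αp}`. -/
theorem stmt4 (V : Type*) [NormedAddCommGroup V] [NormedSpace ℝ V]
    (S : Set V) (M α : ℝ) (hM : 0 < M) (hα : 0 < α)
    (h : ∀ m : ℕ, 1 ≤ m → ENNReal.ofReal (M * (m : ℝ) ^ (-α)) ≤ kolWidth m S)
    (p n : ℕ) (hp : 2 ≤ p) (hn : 4 ≤ n) :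
    ENNReal.ofReal (M * (n : ℝ) ^ (-(α * (p : ℝ)))) ≤ polyKolWidth n p S := by
  classical
  have hnp : 1 ≤ n ^ p := Nat.one_le_pow _ _ (by omega)
  have h0 := h (n ^ p) hnp
  have e : ((n ^ p : ℕ) : ℝ) ^ (-α) = (n : ℝ) ^ (-(α * (p : ℝ))) := by
    rw [Nat.cast_pow, ← Real.rpow_natCast, ← Real.rpow_mul (Nat.cast_nonneg n)]
    congr 1
    ring
  rw [e] at h0
  refine h0.trans ?_
  unfold polyKolWidth
  refine le_iInf fun l => le_iInf fun hl => le_iInf fun D => le_iInf fun hD => ?_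
  obtain ⟨v, hv⟩ := hD
  let U : Submodule ℝ V := Submodule.span ℝ (((multiIndices l p).image v : Finset V) : Set V)
  have hU : Module.rank ℝ U ≤ ((n ^ p : ℕ) : Cardinal) := by
    refine (rank_span_finset_le _).trans ?_
    exact_mod_cast Finset.card_image_le.trans ((card_multiIndices_le l p).trans
      ((Nat.choose_le_choose p (by omega)).trans (choose_le_pow_aux n p hn hp)))
  refine (iInf₂_le U hU).trans ?_
  refine iSup₂_mono fun s _ => ?_
  refine biInf_mono fun t ht => ?_
  obtain ⟨x, rfl⟩ := ht
  rw [hv]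
  exact Submodule.sum_mem _ fun a ha => Submodule.smul_mem _ _
    (Submodule.subset_span (Finset.mem_coe.2 (Finset.mem_image_of_mem v ha)))

end
end
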